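/- For every integer n ≥ 1, the polynomial p_n(x) = x⁴ − (n+6)x³ + (10+n)x² − (n+6)x + 1 is irreducible over ℚ. -/

import Mathlib

open Polynomial

/-- A monic polynomial of degree two is `X ^ 2 + a X + b`. -/
theorem Polynomial.Monic.exists_eq_of_natDegree_eq_two {R : Type*} [CommRing R] {f : R[X]}
    (hf : f.Monic) (hd : f.natDegree = 2) : ∃ a b : R, f = X ^ 2 + C a * X + C b := by
  refine ⟨f.coeff 1, f.coeff 0, ?_⟩
  have h2 : f.coeff 2 = 1 := hd ▸ hf.coeff_natDegree
  conv_lhs => rw [f.as_sum_range_C_mul_X_pow, hd]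
  simp [Finset.sum_range_succ, h2]
  ring

/-- The integer `n ^ 2 + 8 n + 4` is not a square when `n` is positive. -/
theorem Int.sq_ne_sq_add_eight_mul_add_four {n : ℤ} (hn : 1 ≤ n) (k : ℤ) :
    k ^ 2 ≠ n ^ 2 + 8 * n + 4 := by
  intro h
  rw [← sq_abs] at h
  have hk := abs_nonneg k
  generalize |k| = m at h hk
  have h1 : n + 2 < m := by nlinarith
  have h2 : m < n + 4 := by nlinarith
  obtain rfl : m = n + 3 := by omega
  have : 2 * n = 5 := by linarith
  omega

theorem irreducible_reciprocal_quartic_int {n : ℤ} (hn : 1 ≤ n) :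
    Irreducible (X ^ 4 - C (n + 6) * X ^ 3 + C (10 + n) * X ^ 2
      - C (n + 6) * X + 1 : ℤ[X]) := by
  have hdeg : (X ^ 4 - C (n + 6) * X ^ 3 + C (10 + n) * X ^ 2
      - C (n + 6) * X + 1 : ℤ[X]).natDegree = 4 := by compute_degree!
  have hmonic : (X ^ 4 - C (n + 6) * X ^ 3 + C (10 + n) * X ^ 2
      - C (n + 6) * X + 1 : ℤ[X]).Monic := by monicity!
  rw [hmonic.irreducible_iff_natDegree']
  refine ⟨fun h => by rw [h, natDegree_one] at hdeg; omega, fun f g hf hg hfg hmem => ?_⟩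
  rw [hdeg, Finset.mem_Ioc] at hmem
  have hsum : f.natDegree + g.natDegree = 4 := by
    rw [← hf.natDegree_mul hg, hfg, hdeg]
  have heval (x : ℤ) : f.eval x * g.eval x
      = x ^ 4 - (n + 6) * x ^ 3 + (10 + n) * x ^ 2 - (n + 6) * x + 1 := by
    rw [← eval_mul, hfg]
    simp
  obtain hg1 | hg2 : g.natDegree = 1 ∨ g.natDegree = 2 := by omega
  · have hroot : g.eval (-g.coeff 0) = 0 := by
      conv_lhs => rw [hg.eq_X_add_C hg1]
      simp
    have h := heval (-g.coeff 0)
    rw [hroot, mul_zero] at h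
    generalize -g.coeff 0 = z at h
    have hz : IsUnit z := IsUnit.of_mul_eq_one
      (-(z ^ 3 - (n + 6) * z ^ 2 + (10 + n) * z - (n + 6))) (by linarith)
    rcases Int.isUnit_iff.mp hz with rfl | rfl <;> linarith
  · obtain ⟨a, b, rfl⟩ := hf.exists_eq_of_natDegree_eq_two (by omega)
    obtain ⟨c, d, rfl⟩ := hg.exists_eq_of_natDegree_eq_two hg2
    simp only [eval_add, eval_mul, eval_pow, eval_X, eval_C] at heval
    have e0 := heval 0
    have e1 := heval 1
    have e2 := heval (-1)
    have e3 := heval 2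
    have e4 := heval (-2)
    have hbd : b * d = 1 := by linarith
    have h3 : a + c = -(n + 6) := by linarith
    have h1 : a * d + b * c = -(n + 6) := by linarith
    have h2 : a * c + b + d = 10 + n := by linarith
    rcases Int.mul_eq_one_iff_eq_one_or_neg_one.mp hbd with ⟨rfl, rfl⟩ | ⟨rfl, rfl⟩
    · refine Int.sq_ne_sq_add_eight_mul_add_four hn (a - c) ?_
      linear_combination (a + c - (n + 6)) * h3 - 4 * h2
    · linarith

theorem stmt11 (n : ℕ) (hn : 1 ≤ n) :
    Irreducible ((X ^ 4 - C ((n : ℚ) + 6) * X ^ 3 + C (10 + (n : ℚ)) * X ^ 2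
      - C ((n : ℚ) + 6) * X + 1 : Polynomial ℚ)) := by
  have hmonic : (X ^ 4 - C ((n : ℤ) + 6) * X ^ 3 + C (10 + (n : ℤ)) * X ^ 2
      - C ((n : ℤ) + 6) * X + 1 : ℤ[X]).Monic := by monicity!
  have h := (IsPrimitive.Int.irreducible_iff_irreducible_map_cast hmonic.isPrimitive).mp
    (irreducible_reciprocal_quartic_int (by exact_mod_cast hn))
  simpa only [Polynomial.map_add, Polynomial.map_sub, Polynomial.map_mul, Polynomial.map_pow, map_X,
    map_C, Polynomial.map_one, Int.coe_castRingHom, Int.cast_add, Int.cast_natCast,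
    Int.cast_ofNat] using h
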